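/- Let n ≥ 4 and α > 0. Then both of the following Lebesgue integrals are finite and they satisfy ∫₀¹ y^{α} (1−y)^{(n−5)/2} · ( Σ_{m=0}^∞ ((n−3)/2 + m) d_m (1−y)^m ) dy = α · ∫₀¹ y^{α−1} (1−y)^{(n−3)/2} · ( Σ_{m=0}^∞ d_m (1−y)^m ) dy. -/

import Mathlib

open MeasureTheory Set

/-- The recursively defined coefficients `γ_i(m)` from the paper (depending on `n`). -/
noncomputable def gammaCoeff (n : ℕ) : ℕ → ℕ → ℝ
  | 0, _ => 0
  | 1, m => if m = 0 then 1 else 0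
  | (i + 2), m =>
      (Real.Gamma ((m : ℝ) + ((i : ℝ) + 1) * ((i : ℝ) + 2) / (2 * (n : ℝ))) /
        Real.Gamma ((m : ℝ) + ((i : ℝ) + 2) * ((i : ℝ) + 3) / (2 * (n : ℝ)))) *
      ∑ k ∈ Finset.range (m + 1),
        (Real.Gamma (((m - k : ℕ) : ℝ) + ((i : ℝ) + 2) / (n : ℝ)) /
          (Nat.factorial (m - k) : ℝ)) * gammaCoeff n (i + 1) k

/-- `d_m = γ_{n−1}(m)`. -/
noncomputable def dCoeff (n : ℕ) (m : ℕ) : ℝ := gammaCoeff n (n - 1) m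

/-- `G(y) = Σ_{m≥0} d_m (1−y)^m`. -/
noncomputable def Gfun (n : ℕ) (y : ℝ) : ℝ := ∑' m : ℕ, dCoeff n m * (1 - y) ^ m

/-- The product formula `Γ(m + s) = Γ(s) s (s + 1) ⋯ (s + m - 1)`. -/
lemma Gamma_natCast_add (m : ℕ) {s : ℝ} (hs : 0 < s) :
    Real.Gamma (m + s) = Real.Gamma s * ∏ j ∈ Finset.range m, (s + j) := by
  induction m with
  | zero => simp
  | succ m ih =>
    rw [Finset.prod_range_succ, ← mul_assoc, ← ih, mul_comm, add_comm s, ← Real.Gamma_add_one]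
    · congr 1
      push_cast
      ring
    · positivity

lemma GammaSeq_pos {s : ℝ} (hs : 0 < s) (m : ℕ) : 0 < Real.GammaSeq s (m + 1) := by
  unfold Real.GammaSeq
  have : 0 < ∏ j ∈ Finset.range (m + 1 + 1), (s + j) := Finset.prod_pos fun j _ => by positivity
  positivity

lemma Gamma_natCast_add_eq_GammaSeq (m : ℕ) {s : ℝ} (hs : 0 < s) :
    Real.Gamma (m + s) = Real.Gamma s * ((m + 1 : ℝ) ^ s * (m + 1).factorial) /
      (Real.GammaSeq s (m + 1) * ((s + m) * (s + (m + 1)))) := by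
  have : 0 < ∏ j ∈ Finset.range m, (s + j) := Finset.prod_pos fun j _ => by positivity
  rw [Gamma_natCast_add m hs, Real.GammaSeq, Finset.prod_range_succ, Finset.prod_range_succ]
  push_cast
  field_simp

/-- A ratio of Gamma functions grows at most like the expected power. -/
lemma exists_Gamma_div_Gamma_le {p q : ℝ} (hp : 0 < p) (hq : 0 < q) :
    ∃ C : ℝ, 0 ≤ C ∧ ∀ m : ℕ,
      Real.Gamma (m + p) / Real.Gamma (m + q) ≤ C * (m + 1 : ℝ) ^ (p - q) := by
  have hlim : Filter.Tendsto
      (fun m : ℕ => Real.GammaSeq q (m + 1) / Real.GammaSeq p (m + 1)) Filter.atTop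
      (nhds (Real.Gamma q / Real.Gamma p)) :=
    ((Real.GammaSeq_tendsto_Gamma q).comp (Filter.tendsto_add_atTop_nat 1)).div
      ((Real.GammaSeq_tendsto_Gamma p).comp (Filter.tendsto_add_atTop_nat 1))
      (Real.Gamma_pos_of_pos hp).ne'
  obtain ⟨B, hB⟩ := hlim.bddAbove_range
  have hB' (m : ℕ) : Real.GammaSeq q (m + 1) / Real.GammaSeq p (m + 1) ≤ B := hB ⟨m, rfl⟩
  have hB0 : 0 ≤ B := (div_pos (GammaSeq_pos hq 0) (GammaSeq_pos hp 0)).le.trans (hB' 0)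
  have hGp := Real.Gamma_pos_of_pos hp
  have hGq := Real.Gamma_pos_of_pos hq
  have shift {x : ℝ} (hx : 0 ≤ x) : (q + x) / (p + x) ≤ 1 + q / p := by
    rw [div_le_iff₀ (by positivity)]
    have : 0 ≤ q / p * x := by positivity
    have : q / p * p = q := by field_simp
    nlinarith
  refine ⟨Real.Gamma p / Real.Gamma q * B * ((1 + q / p) * (1 + q / p)), by positivity,
    fun m => ?_⟩
  have hSp := GammaSeq_pos hp m
  have hSq := GammaSeq_pos hq m
  calc Real.Gamma (m + p) / Real.Gamma (m + q)
      = Real.Gamma p / Real.Gamma q * (Real.GammaSeq q (m + 1) / Real.GammaSeq p (m + 1)) *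
          ((q + m) / (p + m) * ((q + (m + 1)) / (p + (m + 1)))) * (m + 1 : ℝ) ^ (p - q) := by
        rw [Gamma_natCast_add_eq_GammaSeq m hp, Gamma_natCast_add_eq_GammaSeq m hq,
          Real.rpow_sub (by positivity)]
        field_simp
    _ ≤ _ := by
        gcongr
        · exact hB' m
        · exact shift (by positivity)
        · exact shift (by positivity)

lemma gammaCoeff_nonneg {n : ℕ} (hn : 0 < n) : ∀ i m : ℕ, 0 ≤ gammaCoeff n i m
  | 0, _ => by simp [gammaCoeff]
  | 1, m => by rw [gammaCoeff]; split_ifs <;> norm_num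
  | i + 2, m => by
    rw [gammaCoeff]
    refine mul_nonneg (div_nonneg ?_ ?_) (Finset.sum_nonneg fun k _ =>
      mul_nonneg (div_nonneg ?_ (by positivity)) (gammaCoeff_nonneg hn (i + 1) k))
    all_goals exact (Real.Gamma_pos_of_pos (by positivity)).le

/-- One step of the recursion preserves summability against every negative power. -/
lemma summable_gammaCoeff_succ {n : ℕ} (hn : 0 < n) (i : ℕ)
    (h : ∀ a : ℝ, 0 < a → Summable fun m : ℕ => gammaCoeff n (i + 1) m * (m + 1 : ℝ) ^ (-a))
    {a : ℝ} (ha : 0 < a) :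
    Summable fun m : ℕ => gammaCoeff n (i + 2) m * (m + 1 : ℝ) ^ (-a) := by
  have hn' : (0 : ℝ) < n := by exact_mod_cast hn
  set s : ℝ := ((i : ℝ) + 2) / n with hs
  have hs0 : 0 < s := by positivity
  obtain ⟨C, hC0, hC⟩ := exists_Gamma_div_Gamma_le
    (p := ((i : ℝ) + 1) * ((i : ℝ) + 2) / (2 * (n : ℝ)))
    (q := ((i : ℝ) + 2) * ((i : ℝ) + 3) / (2 * (n : ℝ))) (by positivity) (by positivity)
  have hpq : ((i : ℝ) + 1) * ((i : ℝ) + 2) / (2 * (n : ℝ)) -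
      ((i : ℝ) + 2) * ((i : ℝ) + 3) / (2 * (n : ℝ)) = -s := by
    rw [hs]; field_simp; ring
  rw [hpq] at hC
  obtain ⟨D, hD0, hD⟩ := exists_Gamma_div_Gamma_le hs0 one_pos
  have hpow : Summable fun m : ℕ => (m + 1 : ℝ) ^ (-(1 + a / 2)) := by
    have h0 : Summable fun m : ℕ => (m : ℝ) ^ (-(1 + a / 2)) :=
      Real.summable_nat_rpow.2 (by linarith)
    simpa using (summable_nat_add_iff 1).2 h0
  have hf := h (a / 2) (by positivity)
  have hconv := summable_sum_mul_range_of_summable_norm' hf.norm hf hpow.norm hpow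
  have hnonneg (m : ℕ) : 0 ≤ gammaCoeff n (i + 2) m * (m + 1 : ℝ) ^ (-a) :=
    mul_nonneg (gammaCoeff_nonneg hn (i + 2) m) (by positivity)
  refine Summable.of_nonneg_of_le hnonneg (fun m => ?_) (hconv.mul_left (C * D))
  have hsplit {k : ℕ} (hk : k ≤ m) : (m + 1 : ℝ) ^ (-s) * (m + 1 : ℝ) ^ (-a) ≤
      (k + 1 : ℝ) ^ (-(a / 2)) * (((m - k : ℕ) : ℝ) + 1) ^ (-(s + a / 2)) := by
    rw [← Real.rpow_add (by positivity),
      show -s + -a = -(a / 2) + -(s + a / 2) by ring, Real.rpow_add (by positivity)]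
    have h1 : (k + 1 : ℝ) ≤ m + 1 := by gcongr
    have h2 : ((m - k : ℕ) : ℝ) + 1 ≤ m + 1 := by gcongr; omega
    exact mul_le_mul (Real.rpow_le_rpow_of_nonpos (by positivity) h1 (by linarith))
      (Real.rpow_le_rpow_of_nonpos (by positivity) h2 (by linarith))
      (by positivity) (by positivity)
  have hD' (j : ℕ) : Real.Gamma (j + s) / (Nat.factorial j : ℝ) ≤ D * (j + 1 : ℝ) ^ (s - 1) := by
    simpa only [Real.Gamma_nat_eq_factorial] using hD j
  rw [gammaCoeff, ← hs]
  calc _ ≤ C * (m + 1 : ℝ) ^ (-s) * (∑ k ∈ Finset.range (m + 1),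
          D * (((m - k : ℕ) : ℝ) + 1) ^ (s - 1) * gammaCoeff n (i + 1) k) *
          (m + 1 : ℝ) ^ (-a) := by
        gcongr with k hk
        · exact Finset.sum_nonneg fun k _ => mul_nonneg
            (div_nonneg (Real.Gamma_pos_of_pos (by positivity)).le (by positivity))
            (gammaCoeff_nonneg hn _ _)
        · exact hC m
        · exact gammaCoeff_nonneg hn _ _
        · exact hD' _
    _ = ∑ k ∈ Finset.range (m + 1), C * D * (gammaCoeff n (i + 1) k *
          (((m - k : ℕ) : ℝ) + 1) ^ (s - 1) * ((m + 1 : ℝ) ^ (-s) * (m + 1 : ℝ) ^ (-a))) := by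
        rw [Finset.mul_sum, Finset.sum_mul]
        exact Finset.sum_congr rfl fun k _ => by ring
    _ ≤ ∑ k ∈ Finset.range (m + 1), C * D * (gammaCoeff n (i + 1) k *
          (((m - k : ℕ) : ℝ) + 1) ^ (s - 1) *
          ((k + 1 : ℝ) ^ (-(a / 2)) * (((m - k : ℕ) : ℝ) + 1) ^ (-(s + a / 2)))) := by
        refine Finset.sum_le_sum fun k hk => mul_le_mul_of_nonneg_left
          (mul_le_mul_of_nonneg_left (hsplit (Nat.lt_succ_iff.1 (Finset.mem_range.1 hk)))
            (mul_nonneg (gammaCoeff_nonneg hn _ _) ?_)) ?_ <;> positivity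
    _ = _ := by
        rw [Finset.mul_sum]
        refine Finset.sum_congr rfl fun k _ => ?_
        rw [show -(1 + a / 2) = (s - 1) + -(s + a / 2) by ring, Real.rpow_add (by positivity)]
        ring

lemma summable_gammaCoeff {n : ℕ} (hn : 0 < n) (i : ℕ) :
    ∀ a : ℝ, 0 < a → Summable fun m : ℕ => gammaCoeff n (i + 1) m * (m + 1 : ℝ) ^ (-a) := by
  induction i with
  | zero =>
    intro a _
    refine summable_of_ne_finset_zero (s := {0}) fun m hm => ?_
    rw [gammaCoeff, if_neg (by simpa using hm), zero_mul]
  | succ i ih => exact fun a ha => summable_gammaCoeff_succ hn i ih ha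

lemma integral_beta {u v : ℝ} (hu : 0 < u) (hv : 0 < v) :
    ∫ y in Ioo (0 : ℝ) 1, y ^ (u - 1) * (1 - y) ^ (v - 1) = ProbabilityTheory.beta u v := by
  have hβ := ProbabilityTheory.beta_pos hu hv
  have h := ProbabilityTheory.lintegral_betaPDF_eq_one hu hv
  rw [ProbabilityTheory.lintegral_betaPDF] at h
  have hone : ∫ y in Ioo (0 : ℝ) 1,
      1 / ProbabilityTheory.beta u v * y ^ (u - 1) * (1 - y) ^ (v - 1) = 1 := by
    rw [integral_eq_lintegral_of_nonneg_ae, h, ENNReal.toReal_one]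
    · refine (ae_restrict_mem measurableSet_Ioo).mono fun y hy => ?_
      have := hy.1
      have := sub_pos.2 hy.2
      simp only [Pi.zero_apply]
      positivity
    · exact Measurable.aestronglyMeasurable (by fun_prop)
  simp_rw [mul_assoc] at hone
  rw [integral_const_mul] at hone
  field_simp at hone
  exact hone

lemma integrableOn_beta {u v : ℝ} (hu : 0 < u) (hv : 0 < v) :
    IntegrableOn (fun y : ℝ => y ^ (u - 1) * (1 - y) ^ (v - 1)) (Ioo 0 1) :=
  Integrable.of_integral_ne_zero <| by
    rw [integral_beta hu hv]
    exact (ProbabilityTheory.beta_pos hu hv).ne'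

lemma integrable_tsum_of_nonneg {α : Type*} [MeasurableSpace α] {μ : Measure α} {F : ℕ → α → ℝ}
    (hF : ∀ i, Integrable (F i) μ) (hF0 : ∀ i, 0 ≤ᵐ[μ] F i)
    (hsum : Summable fun i => ∫ x, F i x ∂μ) : Integrable (fun x => ∑' i, F i x) μ := by
  have hmeas (i : ℕ) : AEMeasurable (fun x => ENNReal.ofReal (F i x)) μ :=
    (hF i).aemeasurable.ennreal_ofReal
  have key : Integrable (fun x => (∑' i, ENNReal.ofReal (F i x)).toReal) μ := by
    refine integrable_toReal_of_lintegral_ne_top (AEMeasurable.tsum hmeas) ?_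
    rw [lintegral_tsum hmeas]
    simp_rw [← ofReal_integral_eq_lintegral_ofReal (hF _) (hF0 _)]
    rw [← ENNReal.ofReal_tsum_of_nonneg (fun i => integral_nonneg_of_ae (hF0 i)) hsum]
    exact ENNReal.ofReal_ne_top
  refine key.congr ((ae_all_iff.2 hF0).mono fun x hx => ?_)
  simp only
  rw [ENNReal.tsum_toReal_eq fun i => ENNReal.ofReal_ne_top]
  exact tsum_congr fun i => ENNReal.toReal_ofReal (hx i)

/-- Term-by-term integration of a power series in `1 - y` against a beta weight. -/
lemma integral_beta_mul_tsum {u v : ℝ} (hu : 0 < u) (hv : 0 < v) {c : ℕ → ℝ} (hc : ∀ m, 0 ≤ c m)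
    (hsum : Summable fun m : ℕ => c m * ProbabilityTheory.beta u (v + m)) :
    IntegrableOn (fun y : ℝ => y ^ (u - 1) * (1 - y) ^ (v - 1) * ∑' m : ℕ, c m * (1 - y) ^ m)
      (Ioo 0 1) ∧
    ∫ y in Ioo (0 : ℝ) 1, y ^ (u - 1) * (1 - y) ^ (v - 1) * ∑' m : ℕ, c m * (1 - y) ^ m
      = ∑' m : ℕ, c m * ProbabilityTheory.beta u (v + m) := by
  set F : ℕ → ℝ → ℝ := fun m y => c m * (y ^ (u - 1) * (1 - y) ^ (v + m - 1)) with hF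
  have hvm (m : ℕ) : 0 < v + m := by positivity
  have hFint (m : ℕ) : IntegrableOn (F m) (Ioo 0 1) := (integrableOn_beta hu (hvm m)).const_mul _
  have hF0 (m : ℕ) : ∀ y ∈ Ioo (0 : ℝ) 1, 0 ≤ F m y := fun y hy => by
    have := hy.1
    have := sub_pos.2 hy.2
    have := hc m
    positivity
  have hF0' (m : ℕ) : 0 ≤ᵐ[volume.restrict (Ioo 0 1)] F m :=
    (ae_restrict_mem measurableSet_Ioo).mono (hF0 m)
  have hFval (m : ℕ) :
      ∫ y in Ioo (0 : ℝ) 1, F m y = c m * ProbabilityTheory.beta u (v + m) := by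
    rw [hF, integral_const_mul, integral_beta hu (hvm m)]
  have heq : EqOn (fun y : ℝ => ∑' m, F m y)
      (fun y : ℝ => y ^ (u - 1) * (1 - y) ^ (v - 1) * ∑' m : ℕ, c m * (1 - y) ^ m)
      (Ioo 0 1) := fun y hy => by
    simp only [hF]
    rw [← tsum_mul_left]
    refine tsum_congr fun m => ?_
    rw [show v + m - 1 = v - 1 + m by ring, Real.rpow_add (sub_pos.2 hy.2), Real.rpow_natCast]
    ring
  have hsum' : Summable fun m => ∫ y in Ioo (0 : ℝ) 1, F m y := by simpa only [hFval] using hsum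
  refine ⟨IntegrableOn.congr_fun (integrable_tsum_of_nonneg hFint hF0' hsum') heq
    measurableSet_Ioo, ?_⟩
  rw [← setIntegral_congr_fun measurableSet_Ioo heq,
    ← integral_tsum_of_summable_integral_norm hFint]
  · exact tsum_congr hFval
  · refine hsum'.congr fun m => setIntegral_congr_fun measurableSet_Ioo fun y hy => ?_
    exact (Real.norm_of_nonneg (hF0 m y hy)).symm

lemma summable_dCoeff_mul_beta {n : ℕ} (hn : 2 ≤ n) {a c : ℝ} (ha : 0 < a) (hc : 0 < c) :
    Summable fun m : ℕ => dCoeff n m * ProbabilityTheory.beta a (c + m) := by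
  obtain ⟨i, rfl⟩ := Nat.exists_eq_add_of_le' hn
  have hd (m : ℕ) : 0 ≤ dCoeff (i + 2) m := gammaCoeff_nonneg (by omega) _ m
  obtain ⟨C, -, hC⟩ := exists_Gamma_div_Gamma_le hc (add_pos ha hc)
  refine Summable.of_nonneg_of_le (fun m => mul_nonneg (hd m)
    (ProbabilityTheory.beta_pos ha (by positivity)).le) (fun m => ?_)
    ((summable_gammaCoeff (n := i + 2) (by omega) i a ha).mul_left (Real.Gamma a * C))
  have h := hC m
  rw [show c - (a + c) = -a by ring] at h
  calc dCoeff (i + 2) m * ProbabilityTheory.beta a (c + m)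
      = dCoeff (i + 2) m * (Real.Gamma a * (Real.Gamma (m + c) / Real.Gamma (m + (a + c)))) := by
        rw [ProbabilityTheory.beta, mul_div_assoc, add_comm c, add_left_comm]
    _ ≤ dCoeff (i + 2) m * (Real.Gamma a * (C * (m + 1 : ℝ) ^ (-a))) := by
        have := hd m
        have := (Real.Gamma_pos_of_pos ha).le
        gcongr
    _ = _ := by
        rw [dCoeff, show i + 2 - 1 = i + 1 by omega]
        ring

lemma mul_beta_add_one_left {a c : ℝ} (ha : 0 < a) (hc : 0 < c) :
    c * ProbabilityTheory.beta (a + 1) c = a * ProbabilityTheory.beta a (c + 1) := by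
  simp only [ProbabilityTheory.beta]
  rw [Real.Gamma_add_one ha.ne', Real.Gamma_add_one hc.ne', add_right_comm, ← add_assoc]
  ring

/-- Unbiasedness of the UMVUE `u₀(Y)` of the shape parameter for `n ≥ 4`:
`∫₀¹ y^α (1−y)^{(n−5)/2} Σ ((n−3)/2 + m) d_m (1−y)^m dy
  = α ∫₀¹ y^{α−1} (1−y)^{(n−3)/2} Σ d_m (1−y)^m dy`, both integrals being finite. -/
theorem umvue_shape_unbiased (n : ℕ) (hn : 4 ≤ n) (a : ℝ) (ha : 0 < a) :
    IntegrableOn (fun y : ℝ => y ^ a * (1 - y) ^ (((n : ℝ) - 5) / 2) *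
        ∑' m : ℕ, (((n : ℝ) - 3) / 2 + (m : ℝ)) * dCoeff n m * (1 - y) ^ m) (Ioo 0 1) ∧
    IntegrableOn (fun y : ℝ => y ^ (a - 1) * (1 - y) ^ (((n : ℝ) - 3) / 2) *
        ∑' m : ℕ, dCoeff n m * (1 - y) ^ m) (Ioo 0 1) ∧
    ∫ y in Ioo (0:ℝ) 1, y ^ a * (1 - y) ^ (((n : ℝ) - 5) / 2) *
        ∑' m : ℕ, (((n : ℝ) - 3) / 2 + (m : ℝ)) * dCoeff n m * (1 - y) ^ m
      = a * ∫ y in Ioo (0:ℝ) 1, y ^ (a - 1) * (1 - y) ^ (((n : ℝ) - 3) / 2) *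
        ∑' m : ℕ, dCoeff n m * (1 - y) ^ m := by
  have hn' : (4 : ℝ) ≤ n := by exact_mod_cast hn
  have hd (m : ℕ) : 0 ≤ dCoeff n m := gammaCoeff_nonneg (by omega) _ m
  have hv : 0 < ((n : ℝ) - 3) / 2 := by linarith
  have hterm (m : ℕ) : (((n : ℝ) - 3) / 2 + m) * dCoeff n m *
      ProbabilityTheory.beta (a + 1) (((n : ℝ) - 3) / 2 + m) =
      a * (dCoeff n m * ProbabilityTheory.beta a (((n : ℝ) - 3) / 2 + 1 + m)) := by
    rw [mul_right_comm, mul_beta_add_one_left ha (by positivity),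
      add_right_comm (((n : ℝ) - 3) / 2)]
    ring
  have hsum := summable_dCoeff_mul_beta (n := n) (by omega) ha (add_pos hv one_pos)
  obtain ⟨hI₁, hval₁⟩ := integral_beta_mul_tsum (u := a + 1) (by positivity) hv
    (c := fun m => (((n : ℝ) - 3) / 2 + m) * dCoeff n m)
    (fun m => mul_nonneg (by positivity) (hd m))
    (by simpa only [hterm] using hsum.mul_left a)
  obtain ⟨hI₂, hval₂⟩ := integral_beta_mul_tsum ha (add_pos hv one_pos) hd hsum
  rw [show a + 1 - 1 = a by ring, show ((n : ℝ) - 3) / 2 - 1 = ((n : ℝ) - 5) / 2 by ring]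
    at hI₁ hval₁
  rw [show ((n : ℝ) - 3) / 2 + 1 - 1 = ((n : ℝ) - 3) / 2 by ring] at hI₂ hval₂
  refine ⟨hI₁, hI₂, ?_⟩
  rw [hval₁, hval₂, ← tsum_mul_left]
  exact tsum_congr hterm
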